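/- arXiv:2104.11771 — 2 statements merged into one kernel-verified Lean document; each statement's English description precedes it below -/
import Mathlib

section
/- If γ : S¹ → ℂⁿ is a smooth loop, then the absolute value of the integral of γ*λ_std over S¹ is at most (1/(4π))·(∫_{S¹} |γ'(t)| dt)², which is at most (1/2)·∫_{S¹} |γ'(t)|² dt, where λ_std = (i/4)·Σⱼ (zⱼ dz̄ⱼ - z̄ⱼ dzⱼ) is the standard Liouville 1-form on ℂⁿ. -/
open MeasureTheory Filter Topology Set

/-- **Wirtinger's inequality** for a function on `[0, T]` with equal end values and mean zero. -/
lemma integral_norm_sq_le_of_integral_eq_zero {T : ℝ} (hT : 0 < T) {f f' : ℝ → ℂ}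
    (hf : ∀ x, HasDerivAt f (f' x) x) (hf' : Continuous f') (hper : f 0 = f T)
    (hmean : ∫ x in (0:ℝ)..T, f x = 0) :
    ∫ x in (0:ℝ)..T, ‖f x‖ ^ 2 ≤ (T / (2 * Real.pi)) ^ 2 * ∫ x in (0:ℝ)..T, ‖f' x‖ ^ 2 := by
  have hfc : Continuous f := continuous_iff_continuousAt.2 fun x => (hf x).continuousAt
  have hmem : ∀ g : ℝ → ℂ, Continuous g → MemLp g 2 (volume.restrict (Ioc 0 T)) := fun g hg =>
    (memLp_two_iff_integrable_sq_norm hg.aestronglyMeasurable).2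
      ((intervalIntegrable_iff_integrableOn_Ioc_of_le hT.le).1
        ((hg.norm.pow 2).intervalIntegrable 0 T))
  have h1 := hasSum_sq_fourierCoeffOn hT (hmem f hfc)
  have h2 := (hasSum_sq_fourierCoeffOn hT (hmem f' hf')).mul_left ((T / (2 * Real.pi)) ^ 2)
  have hle : ∀ k : ℤ, ‖fourierCoeffOn hT f k‖ ^ 2 ≤
      (T / (2 * Real.pi)) ^ 2 * ‖fourierCoeffOn hT f' k‖ ^ 2 := by
    intro k
    rcases eq_or_ne k 0 with rfl | hk
    · have : fourierCoeffOn hT f 0 = 0 := by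
        rw [fourierCoeffOn_eq_integral]
        simp [hmean]
      rw [this, norm_zero, zero_pow two_ne_zero]
      positivity
    · rw [fourierCoeffOn_of_hasDerivAt hT hk (fun x _ => hf x) (hf'.intervalIntegrable _ _), hper,
        ← mul_pow]
      have hk1 : (1:ℝ) ≤ |(k:ℝ)| := by exact_mod_cast Int.one_le_abs hk
      gcongr
      simp only [sub_self, mul_zero, zero_sub, norm_mul, norm_neg, norm_div, norm_one,
        Complex.norm_I, Complex.norm_intCast, Complex.norm_real, Complex.ofReal_zero, sub_zero,
        Complex.norm_ofNat, Real.norm_eq_abs, abs_of_pos hT, abs_of_pos Real.pi_pos, mul_one]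
      have hpi := Real.pi_pos
      rw [← mul_assoc]
      gcongr
      rw [one_div_mul_eq_div]
      exact div_le_div_of_nonneg_left hT.le (by positivity)
        (le_mul_of_one_le_right (by positivity) hk1)
  have h3 := hasSum_le hle h1 h2
  simp only [sub_zero, smul_eq_mul] at h3
  rw [mul_left_comm] at h3
  exact le_of_mul_le_mul_left h3 (inv_pos.2 hT)

/-- The action of a closed curve in `ℂ` is controlled by its energy. -/
lemma abs_integral_im_conj_mul_deriv_le {T : ℝ} (hT : 0 < T) {f f' : ℝ → ℂ}
    (hf : ∀ x, HasDerivAt f (f' x) x) (hf' : Continuous f') (hper : f 0 = f T) :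
    |∫ x in (0:ℝ)..T, ((starRingEnd ℂ) (f x) * f' x).im| ≤
      T / (2 * Real.pi) * ∫ x in (0:ℝ)..T, ‖f' x‖ ^ 2 := by
  have hpi := Real.pi_pos
  have hfc : Continuous f := continuous_iff_continuousAt.2 fun x => (hf x).continuousAt
  set m : ℂ := (T : ℂ)⁻¹ * ∫ x in (0:ℝ)..T, f x with hm
  set g : ℝ → ℂ := fun x => f x - m with hg
  have hgc : Continuous g := hfc.sub continuous_const
  have hTc : (T : ℂ) ≠ 0 := by exact_mod_cast hT.ne'
  have hg0 : ∫ x in (0:ℝ)..T, g x = 0 := by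
    rw [hg, intervalIntegral.integral_sub (hfc.intervalIntegrable _ _) (by simp)]
    simp only [intervalIntegral.integral_const, sub_zero, Complex.real_smul, hm]
    field_simp
    ring
  have hW := integral_norm_sq_le_of_integral_eq_zero hT (f := g) (fun x => (hf x).sub_const m) hf'
    (by simp [hg, hper]) hg0
  have hf0 : ∫ x in (0:ℝ)..T, f' x = 0 := by
    rw [intervalIntegral.integral_eq_sub_of_hasDerivAt (fun x _ => hf x)
      (hf'.intervalIntegrable _ _), hper, sub_self]
  have hm0 : ∫ x in (0:ℝ)..T, ((starRingEnd ℂ) m * f' x).im = 0 := by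
    have := Complex.imCLM.intervalIntegral_comp_comm (μ := volume) (a := 0) (b := T)
      (f := fun x => (starRingEnd ℂ) m * f' x)
      ((continuous_const.mul hf').intervalIntegrable _ _)
    simp only [Complex.imCLM_apply] at this
    rw [this, intervalIntegral.integral_const_mul, hf0]
    simp
  have hgm : ∫ x in (0:ℝ)..T, ((starRingEnd ℂ) (f x) * f' x).im =
      ∫ x in (0:ℝ)..T, ((starRingEnd ℂ) (g x) * f' x).im := by
    simp only [hg, map_sub, sub_mul, Complex.sub_im]
    rw [intervalIntegral.integral_sub (Continuous.intervalIntegrable (by fun_prop) _ _)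
      (Continuous.intervalIntegrable (by fun_prop) _ _), hm0, sub_zero]
  set c : ℝ := T / (2 * Real.pi) with hc
  have hcpos : 0 < c := by positivity
  have hpt : ∀ x, |((starRingEnd ℂ) (g x) * f' x).im| ≤
      (1 / (2 * c)) * ‖g x‖ ^ 2 + c / 2 * ‖f' x‖ ^ 2 := by
    intro x
    refine (Complex.abs_im_le_norm _).trans ?_
    rw [norm_mul, RCLike.norm_conj]
    have h : (1 / (2 * c)) * ‖g x‖ ^ 2 + c / 2 * ‖f' x‖ ^ 2 - ‖g x‖ * ‖f' x‖ =
        (1 / (2 * c)) * (‖g x‖ - c * ‖f' x‖) ^ 2 := by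
      field_simp
      ring
    have : 0 ≤ (1 / (2 * c)) * (‖g x‖ - c * ‖f' x‖) ^ 2 := by positivity
    linarith
  rw [hgm]
  calc |∫ x in (0:ℝ)..T, ((starRingEnd ℂ) (g x) * f' x).im|
      ≤ ∫ x in (0:ℝ)..T, |((starRingEnd ℂ) (g x) * f' x).im| :=
        intervalIntegral.abs_integral_le_integral_abs hT.le
    _ ≤ ∫ x in (0:ℝ)..T, ((1 / (2 * c)) * ‖g x‖ ^ 2 + c / 2 * ‖f' x‖ ^ 2) :=
        intervalIntegral.integral_mono_on hT.le
          (Continuous.intervalIntegrable (by fun_prop) _ _)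
          (Continuous.intervalIntegrable (by fun_prop) _ _) fun x _ => hpt x
    _ = (1 / (2 * c)) * (∫ x in (0:ℝ)..T, ‖g x‖ ^ 2) + c / 2 * ∫ x in (0:ℝ)..T, ‖f' x‖ ^ 2 := by
        rw [intervalIntegral.integral_add (Continuous.intervalIntegrable (by fun_prop) _ _)
          (Continuous.intervalIntegrable (by fun_prop) _ _)]
        simp only [intervalIntegral.integral_const_mul]
    _ ≤ (1 / (2 * c)) * (c ^ 2 * ∫ x in (0:ℝ)..T, ‖f' x‖ ^ 2) +
          c / 2 * ∫ x in (0:ℝ)..T, ‖f' x‖ ^ 2 := by gcongr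
    _ = c * ∫ x in (0:ℝ)..T, ‖f' x‖ ^ 2 := by
        field_simp
        ring

/-- The action of a closed curve in `ℂⁿ` is controlled by its energy. -/
lemma abs_action_le_energy {n : ℕ} {T : ℝ} (hT : 0 < T) {η η' : ℝ → EuclideanSpace ℂ (Fin n)}
    (hη : ∀ x, HasDerivAt η (η' x) x) (hη' : Continuous η') (hper : η 0 = η T) :
    |∫ x in (0:ℝ)..T, (1 / 2) * ∑ j, ((starRingEnd ℂ) (η x j) * η' x j).im| ≤
      T / (4 * Real.pi) * ∫ x in (0:ℝ)..T, ‖η' x‖ ^ 2 := by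
  have hηc : Continuous η := continuous_iff_continuousAt.2 fun x => (hη x).continuousAt
  have hd : ∀ j x, HasDerivAt (fun x => η x j) (η' x j) x := fun j x =>
    ((EuclideanSpace.proj (𝕜 := ℂ) j).restrictScalars ℝ).hasFDerivAt.comp_hasDerivAt x (hη x)
  have hc : ∀ j, Continuous fun x => η x j := fun j => by fun_prop
  have hc' : ∀ j, Continuous fun x => η' x j := fun j => by fun_prop
  rw [intervalIntegral.integral_const_mul, intervalIntegral.integral_finsetSum
    (fun j _ => Continuous.intervalIntegrable (by fun_prop) _ _), abs_mul]
  simp only [EuclideanSpace.norm_sq_eq]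
  rw [intervalIntegral.integral_finsetSum
    (fun j _ => Continuous.intervalIntegrable (by fun_prop) _ _)]
  have h := (Finset.abs_sum_le_sum_abs
    (fun j => ∫ x in (0:ℝ)..T, ((starRingEnd ℂ) (η x j) * η' x j).im) Finset.univ).trans
    (Finset.sum_le_sum fun j _ => abs_integral_im_conj_mul_deriv_le hT (hd j) (hc' j)
      (by rw [hper]))
  rw [← Finset.mul_sum] at h
  calc _ ≤ |(1 / 2 : ℝ)| * (T / (2 * Real.pi) *
        ∑ j, ∫ x in (0:ℝ)..T, ‖η' x j‖ ^ 2) := by gcongr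
    _ = _ := by
      rw [abs_of_pos (by norm_num), ← mul_assoc]
      congr 1
      field_simp
      ring

/-- The primitive of a continuous function bounded below by a positive constant has a global
differentiable inverse. -/
lemma exists_inverse_of_primitive {w : ℝ → ℝ} (hw : Continuous w) {ε : ℝ} (hε : 0 < ε)
    (hle : ∀ x, ε ≤ w x) :
    ∃ φ : ℝ → ℝ, (∀ u, HasDerivAt φ (w (φ u))⁻¹ u) ∧
      ∀ a, φ (∫ x in (0:ℝ)..a, w x) = a := by
  set s : ℝ → ℝ := fun a => ∫ x in (0:ℝ)..a, w x with hs
  have hd : ∀ x, HasDerivAt s (w x) x := fun x => hw.integral_hasStrictDerivAt 0 x |>.hasDerivAt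
  have hsc : Continuous s := continuous_iff_continuousAt.2 fun x => (hd x).continuousAt
  have hmono : StrictMono s := strictMono_of_hasDerivAt_pos hd fun x => hε.trans_le (hle x)
  have hs0 : s 0 = 0 := by simp [hs]
  have hd' : ∀ x, HasDerivAt (fun x => s x - ε * x) (w x - ε * 1) x := fun x =>
    (hd x).sub ((hasDerivAt_id x).const_mul ε)
  have hmono' : Monotone fun x => s x - ε * x :=
    monotone_of_deriv_nonneg (fun x => (hd' x).differentiableAt) fun x => by
      rw [(hd' x).deriv]
      linarith [hle x]
  have htop : Tendsto s atTop atTop :=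
    tendsto_atTop_mono' _ (by
      filter_upwards [eventually_ge_atTop 0] with x hx
      have := hmono' hx
      simp only [hs0] at this
      simp only [id]
      linarith) (tendsto_id.const_mul_atTop hε)
  have hbot : Tendsto s atBot atBot :=
    tendsto_atBot_mono' _ (by
      filter_upwards [eventually_le_atBot 0] with x hx
      have := hmono' hx
      simp only [hs0] at this
      simp only [id]
      linarith) (tendsto_id.const_mul_atBot hε)
  have hsurj : Function.Surjective s := hsc.surjective htop hbot
  let e := hmono.orderIsoOfSurjective s hsurj
  have he : ∀ u, s (e.symm u) = u := fun u => e.apply_symm_apply u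
  refine ⟨e.symm, fun u => ?_, fun a => e.symm_apply_apply a⟩
  exact HasDerivAt.of_local_left_inverse e.symm.continuous.continuousAt (hd _)
    (hε.trans_le (hle _)).ne' (Eventually.of_forall he)

/-- Isoperimetric inequality up to an error `ε` in the speed. -/
lemma abs_action_le_of_speed_add {n : ℕ} {a : ℝ} (ha : 0 < a)
    {γ γ' : ℝ → EuclideanSpace ℂ (Fin n)} (hγ : ∀ x, HasDerivAt γ (γ' x) x)
    (hγ' : Continuous γ') (hper : γ 0 = γ a) {ε : ℝ} (hε : 0 < ε) :
    |∫ x in (0:ℝ)..a, (1 / 2) * ∑ j, ((starRingEnd ℂ) (γ x j) * γ' x j).im| ≤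
      1 / (4 * Real.pi) * ((∫ x in (0:ℝ)..a, ‖γ' x‖) + a * ε) ^ 2 := by
  have hγc : Continuous γ := continuous_iff_continuousAt.2 fun x => (hγ x).continuousAt
  set w : ℝ → ℝ := fun x => ‖γ' x‖ + ε with hw
  have hwc : Continuous w := by fun_prop
  have hwpos : ∀ x, 0 < w x := fun x => by positivity
  obtain ⟨φ, hφ, hφa⟩ := exists_inverse_of_primitive hwc hε fun x => by simp [hw]
  have hφc : Continuous φ := continuous_iff_continuousAt.2 fun x => (hφ x).continuousAt
  have hφ'c : Continuous fun u => (w (φ u))⁻¹ :=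
    (hwc.comp hφc).inv₀ fun u => (hwpos _).ne'
  have hφ0 : φ 0 = 0 := by simpa using hφa 0
  set T : ℝ := ∫ x in (0:ℝ)..a, w x with hTdef
  have hT : 0 < T := intervalIntegral.intervalIntegral_pos_of_pos
    (hwc.intervalIntegrable _ _) hwpos ha
  have hTL : T = (∫ x in (0:ℝ)..a, ‖γ' x‖) + a * ε := by
    rw [hTdef, hw, intervalIntegral.integral_add (hγ'.norm.intervalIntegrable _ _) (by simp)]
    simp
  have hact := abs_action_le_energy hT (η := γ ∘ φ) (η' := fun u => (w (φ u))⁻¹ • γ' (φ u))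
    (fun u => (hγ (φ u)).scomp u (hφ u)) (hφ'c.smul (hγ'.comp hφc))
    (by rw [Function.comp_apply, Function.comp_apply, hφ0, hφa a, hper])
  have hcov := intervalIntegral.integral_comp_mul_deriv (a := 0) (b := T) (f := φ)
    (f' := fun u => (w (φ u))⁻¹)
    (g := fun x => (1 / 2) * ∑ j, ((starRingEnd ℂ) (γ x j) * γ' x j).im)
    (fun u _ => hφ u) hφ'c.continuousOn (by fun_prop)
  rw [hφ0, hφa a] at hcov
  rw [← hcov, ← hTL]
  have henergy : ∫ u in (0:ℝ)..T, ‖(w (φ u))⁻¹ • γ' (φ u)‖ ^ 2 ≤ T := by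
    calc _ ≤ ∫ u in (0:ℝ)..T, (1:ℝ) := by
          refine intervalIntegral.integral_mono_on hT.le
            (Continuous.intervalIntegrable ?_ _ _) (by simp) fun u _ => ?_
          · exact ((hφ'c.smul (hγ'.comp hφc)).norm.pow 2)
          · rw [norm_smul, norm_inv, Real.norm_of_nonneg (hwpos _).le]
            refine pow_le_one₀ (by have := hwpos (φ u); positivity) ?_
            rw [inv_mul_le_one₀ (hwpos _)]
            simp only [hw]
            linarith
      _ = T := by simp
  calc _ = _ := by
        congr 1
        refine intervalIntegral.integral_congr fun u _ => ?_
        simp only [Function.comp_apply, PiLp.smul_apply, Complex.real_smul, mul_left_comm _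
          (((w (φ u))⁻¹ : ℝ) : ℂ), Complex.im_ofReal_mul, ← Finset.mul_sum]
        ring
    _ ≤ _ := hact
    _ ≤ T / (4 * Real.pi) * T := by
        have := Real.pi_pos
        gcongr
    _ = _ := by ring

/-- Cauchy–Schwarz against the constant function. -/
lemma sq_integral_le_mul_integral_sq {a : ℝ} (ha : 0 < a) {v : ℝ → ℝ} (hv : Continuous v) :
    (∫ x in (0:ℝ)..a, v x) ^ 2 ≤ a * ∫ x in (0:ℝ)..a, v x ^ 2 := by
  set L := ∫ x in (0:ℝ)..a, v x with hL
  have h : 0 ≤ ∫ x in (0:ℝ)..a, (v x - L / a) ^ 2 :=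
    intervalIntegral.integral_nonneg ha.le fun x _ => sq_nonneg _
  have h2 : ∫ x in (0:ℝ)..a, (v x - L / a) ^ 2 = (∫ x in (0:ℝ)..a, v x ^ 2) - L ^ 2 / a := by
    have : ∀ x, (v x - L / a) ^ 2 = v x ^ 2 - 2 * (L / a) * v x + (L / a) ^ 2 := fun x => by ring
    simp only [this]
    rw [intervalIntegral.integral_add (Continuous.intervalIntegrable (by fun_prop) _ _) (by simp),
      intervalIntegral.integral_sub (Continuous.intervalIntegrable (by fun_prop) _ _)
        (Continuous.intervalIntegrable (by fun_prop) _ _), intervalIntegral.integral_const_mul,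
      ← hL]
    simp only [intervalIntegral.integral_const, smul_eq_mul, sub_zero]
    field_simp
    ring
  rw [h2, sub_nonneg, div_le_iff₀ ha] at h
  linarith

/-- Isoperimetric inequality for loops in ℂⁿ. For a smooth
2π-periodic loop γ : ℝ → ℂⁿ, the action `∫ γ*λ_std` (which equals
`∫ (1/2)·Σⱼ Im(conj(γⱼ)·γⱼ')`) satisfies
`|∫ γ*λ_std| ≤ (1/(4π))·(∫|γ'|)² ≤ (1/2)·∫|γ'|²`. -/
theorem loop_isoperimetric (n : ℕ) (γ : ℝ → EuclideanSpace ℂ (Fin n))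
    (hsmooth : ContDiff ℝ (⊤ : ℕ∞) γ) (hper : Function.Periodic γ (2 * Real.pi)) :
    |∫ t in (0:ℝ)..(2 * Real.pi),
        (1 / 2) * ∑ j, ((starRingEnd ℂ) (γ t j) * deriv γ t j).im| ≤
      (1 / (4 * Real.pi)) * (∫ t in (0:ℝ)..(2 * Real.pi), ‖deriv γ t‖) ^ 2 ∧
    (1 / (4 * Real.pi)) * (∫ t in (0:ℝ)..(2 * Real.pi), ‖deriv γ t‖) ^ 2 ≤
      (1 / 2) * ∫ t in (0:ℝ)..(2 * Real.pi), ‖deriv γ t‖ ^ 2 := by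
  have hpi := Real.pi_pos
  have hd : ∀ x, HasDerivAt γ (deriv γ x) x := fun x =>
    (hsmooth.differentiable (by simp) x).hasDerivAt
  have hc : Continuous (deriv γ) := hsmooth.continuous_deriv (by exact_mod_cast le_top)
  constructor
  · have hlim : Tendsto (fun ε : ℝ => 1 / (4 * Real.pi) *
        ((∫ t in (0:ℝ)..(2 * Real.pi), ‖deriv γ t‖) + 2 * Real.pi * ε) ^ 2) (𝓝[>] 0)
        (𝓝 (1 / (4 * Real.pi) *
          ((∫ t in (0:ℝ)..(2 * Real.pi), ‖deriv γ t‖) + 2 * Real.pi * 0) ^ 2)) :=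
      (Continuous.tendsto (by fun_prop) 0).mono_left nhdsWithin_le_nhds
    rw [mul_zero, add_zero] at hlim
    refine ge_of_tendsto hlim ?_
    filter_upwards [self_mem_nhdsWithin] with ε hε
    exact abs_action_le_of_speed_add (by positivity) hd hc (by simpa using (hper 0).symm) hε
  · calc _ ≤ 1 / (4 * Real.pi) *
          (2 * Real.pi * ∫ t in (0:ℝ)..(2 * Real.pi), ‖deriv γ t‖ ^ 2) := by
          gcongr
          exact sq_integral_le_mul_integral_sq (by positivity) hc.norm
      _ = _ := by
          field_simp
          ring
end

section
/- For every integer n ≥ 2, the number T_n of isomorphism classes of stable rooted trees with n+1 half edges (isomorphisms required to preserve the root edge) satisfies T_n ≤ (1/(4√3))·(2ⁿ/√n)³. -/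
/-- A stable rooted tree with `n+1` half edges: a finite tree with half edges
(boundary map `bd : Fin nE → Finset (Fin nV)` with 1 or 2 endpoints per edge,
the induced simple graph being a tree and full edges having distinct endpoint
sets), every vertex of degree ≥ 3, exactly `n+1` half edges, and a distinguished
root half edge. -/
structure StableRootedTree (n : ℕ) where
  nV : ℕ
  nE : ℕ
  bd : Fin nE → Finset (Fin nV)
  hcard : ∀ e, (bd e).card = 1 ∨ (bd e).card = 2
  htree : (SimpleGraph.fromRel fun u v => ∃ e, bd e = {u, v}).IsTree
  hinj : Set.InjOn bd {e | (bd e).card = 2}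
  hstable : ∀ v, 3 ≤ (Finset.univ.filter fun e => v ∈ bd e).card
  hhalf : (Finset.univ.filter fun e => (bd e).card = 1).card = n + 1
  root : Fin nE
  hroot : (bd root).card = 1

/-- Isomorphism of stable rooted trees, preserving the root edge. -/
def TreeIso {n : ℕ} (t t' : StableRootedTree n) : Prop :=
  ∃ (σ : Fin t.nV ≃ Fin t'.nV) (τ : Fin t.nE ≃ Fin t'.nE),
    (∀ e, (t.bd e).image σ = t'.bd (τ e)) ∧ τ t.root = t'.root

namespace BinaryTree

/-- The labels of the internal nodes of a binary tree, in preorder. -/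
def labels {α : Type*} : BinaryTree α → List α
  | nil => []
  | node a l r => a :: (l.labels ++ r.labels)

theorem length_labels {α : Type*} (x : BinaryTree α) : x.labels.length = x.numNodes := by
  induction x with
  | nil => rfl
  | node a l r hl hr => simp [labels, hl, hr]

theorem numNodes_map {α β : Type*} (f : α → β) (x : BinaryTree α) :
    (x.map f).numNodes = x.numNodes := by
  induction x with
  | nil => rfl
  | node a l r hl hr => simp [map, hl, hr]

theorem eq_of_map_eq_of_labels_eq {α β : Type*} {f : α → β} {x y : BinaryTree α}
    (hmap : x.map f = y.map f) (hlabels : x.labels = y.labels) : x = y := by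
  induction x generalizing y with
  | nil => cases y with
    | nil => rfl
    | node => simp [map] at hmap
  | node a l r hl hr => cases y with
    | nil => simp [map] at hmap
    | node b l' r' =>
      simp only [map, node.injEq] at hmap
      simp only [labels, List.cons.injEq] at hlabels
      have hlen : l.labels.length = l'.labels.length := by
        rw [length_labels, length_labels, ← numNodes_map f l, hmap.2.1, numNodes_map]
      obtain ⟨h₁, h₂⟩ := List.append_inj hlabels.2 hlen
      rw [hlabels.1, hl hmap.2.1 h₁, hr hmap.2.2 h₂]

/-- A binary tree labelled by `Bool` as its shape together with the list of its labels. -/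
def shapeLabels (m : ℕ) (x : {x : BinaryTree Bool // x.numNodes = m}) :
    treesOfNumNodesEq m × List.Vector Bool m :=
  (⟨x.1.map fun _ => (), by rw [mem_treesOfNumNodesEq, numNodes_map, x.2]⟩,
    ⟨x.1.labels, by rw [length_labels, x.2]⟩)

theorem shapeLabels_injective (m : ℕ) : Function.Injective (shapeLabels m) := by
  rintro ⟨x, hx⟩ ⟨y, hy⟩ h
  exact Subtype.ext (eq_of_map_eq_of_labels_eq
    (congrArg (fun p => p.1.1) h) (congrArg (fun p => p.2.1) h))

instance finite_numNodes_eq (m : ℕ) : Finite {x : BinaryTree Bool // x.numNodes = m} :=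
  Finite.of_injective _ (shapeLabels_injective m)

theorem card_numNodes_eq_le (m : ℕ) :
    Nat.card {x : BinaryTree Bool // x.numNodes = m} ≤ catalan m * 2 ^ m := by
  refine (Nat.card_le_card_of_injective _ (shapeLabels_injective m)).trans_eq ?_
  rw [Nat.card_prod, Nat.card_eq_fintype_card, Nat.card_eq_fintype_card, Fintype.card_coe,
    treesOfNumNodesEq_card_eq_catalan, card_vector, Fintype.card_bool]

/-- Merge a list of binary trees along a right spine. All spine nodes but the first one carry
the label `true`, so that the list can be recovered when no entry has a root labelled `true`. -/
def comb : Bool → List (BinaryTree Bool) → BinaryTree Bool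
  | _, [] => nil
  | _, [c] => c
  | b, c :: d :: l => node b c (comb true (d :: l))

/-- The root of the tree, if there is one, is not labelled `true`. -/
def RootNotTrue (c : BinaryTree Bool) : Prop := ∀ x y, c ≠ node true x y

theorem rootNotTrue_comb_false {l : List (BinaryTree Bool)} (hl : l.length ≠ 1) :
    RootNotTrue (comb false l) := by
  intro x y
  match l with
  | [] => simp [comb]
  | [c] => simp at hl
  | c :: d :: l => simp [comb]

theorem comb_true_inj {l l' : List (BinaryTree Bool)} (hl : l ≠ []) (hl' : l' ≠ [])
    (h : ∀ c ∈ l, RootNotTrue c) (h' : ∀ c ∈ l', RootNotTrue c)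
    (heq : comb true l = comb true l') : l = l' := by
  induction l generalizing l' with
  | nil => exact absurd rfl hl
  | cons c l ih =>
    match l, l' with
    | _, [] => exact absurd rfl hl'
    | [], [c'] => simpa [comb] using heq
    | [], c' :: d' :: l' => exact absurd heq (h c (by simp) _ _)
    | d :: l, [c'] => exact absurd heq.symm (h' c' (by simp) _ _)
    | d :: l, c' :: d' :: l' =>
      simp only [comb, node.injEq, true_and] at heq
      rw [heq.1, ih (by simp) (by simp) (fun x hx => h x (by simp_all))
        (fun x hx => h' x (by simp_all)) heq.2]

theorem comb_false_inj {l l' : List (BinaryTree Bool)} (hl : l.length ≠ 1) (hl' : l'.length ≠ 1)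
    (h : ∀ c ∈ l, RootNotTrue c) (h' : ∀ c ∈ l', RootNotTrue c)
    (heq : comb false l = comb false l') : l = l' := by
  match l, l' with
  | [c], _ => simp at hl
  | _, [c'] => simp at hl'
  | [], [] => rfl
  | [], c' :: d' :: l' => simp [comb] at heq
  | c :: d :: l, [] => simp [comb] at heq
  | c :: d :: l, c' :: d' :: l' =>
    simp only [comb, node.injEq, true_and] at heq
    rw [heq.1, comb_true_inj (by simp) (by simp) (fun x hx => h x (by simp_all))
      (fun x hx => h' x (by simp_all)) heq.2]

theorem numLeaves_comb (b : Bool) {l : List (BinaryTree Bool)} (hl : l ≠ []) :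
    (comb b l).numLeaves = (l.map numLeaves).sum := by
  induction l generalizing b with
  | nil => exact absurd rfl hl
  | cons c l ih =>
    match l with
    | [] => simp [comb]
    | d :: l => rw [comb, numLeaves, ih true (by simp)]; simp

end BinaryTree

/-- A finite rooted tree given by its parent map (the value at the root is irrelevant), in which
no element has exactly one child. -/
structure ParentTree (E : Type*) where
  root : E
  parent : E → E
  depth : E → ℕ
  depth_parent : ∀ e, e ≠ root → depth (parent e) < depth e
  ncard_ne_one : ∀ e, {a | a ≠ root ∧ parent a = e}.ncard ≠ 1

namespace ParentTree

variable {E F : Type*} [Fintype E] [Fintype F]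

open Classical in
/-- The children of an element, listed in an arbitrary order. -/
noncomputable def children (P : ParentTree E) (e : E) : List E :=
  (Finset.univ.filter fun a => a ≠ P.root ∧ P.parent a = e).toList

theorem mem_children {P : ParentTree E} {a e : E} :
    a ∈ P.children e ↔ a ≠ P.root ∧ P.parent a = e := by
  simp [children]

theorem nodup_children (P : ParentTree E) (e : E) : (P.children e).Nodup :=
  Finset.nodup_toList _

theorem length_children_ne_one (P : ParentTree E) (e : E) : (P.children e).length ≠ 1 := by
  rw [children, Finset.length_toList, ← Set.ncard_coe_finset]
  simpa using P.ncard_ne_one e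

/-- The binary tree encoding the subtree below an element. -/
noncomputable def code (P : ParentTree E) (e : E) : BinaryTree Bool :=
  .comb false ((P.children e).attach.map fun a => P.code a.1)
termination_by Finset.univ.sup P.depth - P.depth e
decreasing_by
  obtain ⟨h, he⟩ := mem_children.1 a.2
  have h₁ := P.depth_parent _ h
  rw [he] at h₁
  have h₂ : P.depth a.1 ≤ Finset.univ.sup P.depth := Finset.le_sup (Finset.mem_univ _)
  omega

theorem code_eq (P : ParentTree E) (e : E) :
    P.code e = .comb false ((P.children e).map P.code) := by
  rw [code, List.attach_map_val (f := P.code)]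

theorem rootNotTrue_code (P : ParentTree E) (e : E) : (P.code e).RootNotTrue := by
  rw [code_eq]
  exact BinaryTree.rootNotTrue_comb_false (by simpa using P.length_children_ne_one e)

theorem map_code_children_eq {P : ParentTree E} {Q : ParentTree F} {e : E} {f : F}
    (h : P.code e = Q.code f) : (P.children e).map P.code = (Q.children f).map Q.code := by
  rw [P.code_eq, Q.code_eq] at h
  refine BinaryTree.comb_false_inj (by simpa using P.length_children_ne_one e)
    (by simpa using Q.length_children_ne_one f) ?_ ?_ h
  · simpa using fun a _ => P.rootNotTrue_code a
  · simpa using fun a _ => Q.rootNotTrue_code a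

open Classical in
theorem numLeaves_code_root (P : ParentTree E) :
    (P.code P.root).numLeaves = (Finset.univ.filter fun e => P.children e = []).card := by
  have key : ∀ e, (P.code e).numLeaves = (if P.children e = [] then 1 else 0) +
      ∑ a ∈ Finset.univ.filter (fun a => a ≠ P.root ∧ P.parent a = e), (P.code a).numLeaves := by
    intro e
    have hsum : ∑ a ∈ Finset.univ.filter (fun a => a ≠ P.root ∧ P.parent a = e),
        (P.code a).numLeaves = ((P.children e).map fun a => (P.code a).numLeaves).sum :=
      (Finset.sum_map_toList _ _).symm
    rw [hsum]
    split_ifs with h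
    · rw [code_eq, h]; simp [BinaryTree.comb]
    · rw [code_eq, BinaryTree.numLeaves_comb _ (by simpa using h), List.map_map, zero_add]
      rfl
  have htotal := Finset.sum_congr (rfl : (Finset.univ : Finset E) = Finset.univ)
    fun e _ => key e
  have hfiber : ∑ e, ∑ a ∈ Finset.univ.filter (fun a => a ≠ P.root ∧ P.parent a = e),
      (P.code a).numLeaves = ∑ a ∈ Finset.univ.erase P.root, (P.code a).numLeaves := by
    rw [← Finset.sum_fiberwise (Finset.univ.erase P.root) P.parent]
    refine Finset.sum_congr rfl fun e _ => Finset.sum_congr ?_ fun _ _ => rfl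
    ext a
    simp
  rw [Finset.sum_add_distrib, hfiber, ← Finset.add_sum_erase _ _ (Finset.mem_univ P.root)]
    at htotal
  rw [Finset.card_filter]
  omega

/-- Elements at the same position in two trees with ordered children. -/
inductive Corr (P : ParentTree E) (Q : ParentTree F) : E → F → Prop
  | root : Corr P Q P.root Q.root
  | child {e f a b} {i : ℕ} : Corr P Q e f → (P.children e)[i]? = some a →
      (Q.children f)[i]? = some b → Corr P Q a b

theorem Corr.symm {P : ParentTree E} {Q : ParentTree F} {e : E} {f : F} (h : Corr P Q e f) :
    Corr Q P f e := by
  induction h with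
  | root => exact .root
  | child _ ha hb ih => exact .child ih hb ha

theorem Corr.code_eq {P : ParentTree E} {Q : ParentTree F} (hPQ : P.code P.root = Q.code Q.root)
    {e : E} {f : F} (h : Corr P Q e f) : P.code e = Q.code f := by
  induction h with
  | root => exact hPQ
  | @child e f a b i _ ha hb ih =>
    have := congrArg (·[i]?) (map_code_children_eq ih)
    simpa [ha, hb] using this

theorem Corr.unique {P : ParentTree E} {Q : ParentTree F} {e : E} {f f' : F}
    (h : Corr P Q e f) (h' : Corr P Q e f') : f = f' := by
  induction h generalizing f' with
  | root =>
    cases h' with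
    | root => rfl
    | child _ ha _ => exact absurd rfl (mem_children.1 (List.mem_of_getElem? ha)).1
  | @child e f a b i _ ha hb ih =>
    have hmem := mem_children.1 (List.mem_of_getElem? ha)
    generalize hc : a = c at h'
    cases h' with
    | root => exact absurd hc hmem.1
    | @child e' f₁ _ _ j he' ha' hb' =>
      subst hc
      obtain rfl : e = e' := hmem.2.symm.trans (mem_children.1 (List.mem_of_getElem? ha')).2
      obtain rfl := ih he'
      have hij : i = j := (List.getElem?_inj
        (List.getElem?_eq_some_iff.1 ha).1 (P.nodup_children e)).1 (ha.trans ha'.symm)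
      subst hij
      exact Option.some.inj (hb.symm.trans hb')

theorem Corr.exists_right {P : ParentTree E} {Q : ParentTree F}
    (hPQ : P.code P.root = Q.code Q.root) (e : E) : ∃ f, Corr P Q e f := by
  induction hd : P.depth e using Nat.strong_induction_on generalizing e with
  | _ d ih =>
    by_cases he : e = P.root
    · exact ⟨Q.root, he ▸ Corr.root⟩
    · obtain ⟨f, hf⟩ := ih _ (hd ▸ P.depth_parent e he) (P.parent e) rfl
      obtain ⟨i, hi⟩ := List.mem_iff_getElem?.1 (mem_children.2 ⟨he, rfl⟩)
      have := congrArg (·[i]?) (map_code_children_eq (hf.code_eq hPQ))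
      simp only [List.getElem?_map, hi, Option.map_some] at this
      obtain ⟨b, hb, -⟩ := Option.map_eq_some_iff.1 this.symm
      exact ⟨b, .child hf hi hb⟩

theorem exists_equiv_of_code_eq {P : ParentTree E} {Q : ParentTree F}
    (hPQ : P.code P.root = Q.code Q.root) :
    ∃ τ : E ≃ F, τ P.root = Q.root ∧ ∀ e, e ≠ P.root → τ (P.parent e) = Q.parent (τ e) := by
  choose τ hτ using Corr.exists_right hPQ
  choose τ' hτ' using Corr.exists_right hPQ.symm
  refine ⟨⟨τ, τ', fun e => (hτ' _).unique (hτ e).symm, fun f => (hτ _).unique (hτ' f).symm⟩,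
    (hτ _).unique .root, fun e he => ?_⟩
  have h := hτ e
  change τ (P.parent e) = Q.parent (τ e)
  generalize τ e = f at h
  cases h with
  | root => exact absurd rfl he
  | child hef ha hb =>
    rw [(mem_children.1 (List.mem_of_getElem? ha)).2,
      (mem_children.1 (List.mem_of_getElem? hb)).2]
    exact (hτ _).unique hef

end ParentTree

theorem SimpleGraph.IsTree.eq_of_adj_of_dist_add_one_eq {V : Type*} {G : SimpleGraph V}
    (hG : G.IsTree) {r u v w : V} (hu : G.Adj u w) (hv : G.Adj v w)
    (hdu : G.dist r u + 1 = G.dist r w) (hdv : G.dist r v + 1 = G.dist r w) : u = v := by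
  obtain ⟨p, hp⟩ := hG.connected.exists_walk_length_eq_dist r u
  obtain ⟨q, hq⟩ := hG.connected.exists_walk_length_eq_dist r v
  have hp' : (p.concat hu).IsPath :=
    SimpleGraph.Walk.isPath_of_length_eq_dist _ (by simp [hp, hdu])
  have hq' : (q.concat hv).IsPath :=
    SimpleGraph.Walk.isPath_of_length_eq_dist _ (by simp [hq, hdv])
  have := congrArg SimpleGraph.Walk.penultimate ((hG.existsUnique_path r w).unique hp' hq')
  simpa using this

theorem SimpleGraph.Connected.exists_adj_dist_add_one_eq {V : Type*} {G : SimpleGraph V}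
    (hG : G.Connected) {r w : V} (hw : w ≠ r) : ∃ u, G.Adj u w ∧ G.dist r u + 1 = G.dist r w := by
  obtain ⟨p, hp⟩ := hG.exists_walk_length_eq_dist r w
  have hnil : ¬ p.Nil := fun h => hw h.eq.symm
  refine ⟨p.penultimate, p.adj_penultimate hnil, ?_⟩
  have h₁ : G.dist r p.penultimate ≤ p.dropLast.length := SimpleGraph.dist_le _
  have h₂ := (p.adj_penultimate hnil).diff_dist_adj (u := r)
  have h₃ : p.dropLast.length + 1 = p.length := by
    rw [← SimpleGraph.Walk.length_concat p.dropLast (p.adj_penultimate hnil),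
      SimpleGraph.Walk.concat_dropLast]
  omega

namespace StableRootedTree

variable {n : ℕ}

/-- The simple graph spanned by the full edges. -/
def graph (t : StableRootedTree n) : SimpleGraph (Fin t.nV) :=
  SimpleGraph.fromRel fun u v => ∃ e, t.bd e = {u, v}

theorem graph_adj {t : StableRootedTree n} {u v : Fin t.nV} :
    t.graph.Adj u v ↔ u ≠ v ∧ ∃ e, t.bd e = {u, v} := by
  simp only [graph, SimpleGraph.fromRel_adj, Finset.pair_comm v u, or_self]

/-- The vertex carrying the root half edge. -/
theorem exists_bd_root (t : StableRootedTree n) : ∃ r, t.bd t.root = {r} :=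
  Finset.card_eq_one.1 t.hroot

/-- Every vertex has an edge above it: the root edge at the root vertex, and the edge to the
neighbour closer to the root vertex elsewhere. -/
theorem exists_above (t : StableRootedTree n) {r : Fin t.nV} (hr : t.bd t.root = {r})
    (v : Fin t.nV) : ∃ e, v ∈ t.bd e ∧ (v = r → e = t.root) ∧
      (v ≠ r → ∃ p, p ≠ v ∧ t.bd e = {p, v} ∧ t.graph.dist r p + 1 = t.graph.dist r v) := by
  by_cases hv : v = r
  · exact ⟨t.root, by simp [hr, hv], fun _ => rfl, fun h => absurd hv h⟩
  · obtain ⟨p, hadj, hp⟩ := SimpleGraph.Connected.exists_adj_dist_add_one_eq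
      (G := t.graph) t.htree.connected hv
    obtain ⟨hne, e, he⟩ := graph_adj.1 hadj
    exact ⟨e, by simp [he], fun h => absurd h hv, fun _ => ⟨p, hne, he, hp⟩⟩

/-- The tree of edges of a stable rooted tree, where `up v` is the edge above the vertex `v`. -/
theorem exists_parentTree (t : StableRootedTree n) :
    ∃ (P : ParentTree (Fin t.nE)) (up : Fin t.nV → Fin t.nE), Function.Injective up ∧
      P.root = t.root ∧
      (∀ v e, v ∈ t.bd e ↔ e = up v ∨ (e ≠ P.root ∧ P.parent e = up v)) ∧
      (∀ e, e ∈ Set.range up ↔ ∃ a, a ≠ P.root ∧ P.parent a = e) ∧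
      (∀ e, e ∉ Set.range up ↔ e ≠ t.root ∧ (t.bd e).card = 1) := by
  obtain ⟨r, hr⟩ := t.exists_bd_root
  choose up hmem hup_root hup using t.exists_above hr
  have hroot : up r = t.root := hup_root r rfl
  have hcard : ∀ v, v ≠ r → (t.bd (up v)).card = 2 := fun v hv => by
    obtain ⟨p, hne, he, -⟩ := hup v hv
    rw [he, Finset.card_pair hne]
  have hinj : Function.Injective up := by
    intro v w h
    by_cases hv : v = r <;> by_cases hw : w = r
    · rw [hv, hw]
    · have := hcard w hw
      rw [← h, hv, hroot, t.hroot] at this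
      omega
    · have := hcard v hv
      rw [h, hw, hroot, t.hroot] at this
      omega
    · obtain ⟨p, hne, he, hp⟩ := hup v hv
      obtain ⟨q, hne', he', hq⟩ := hup w hw
      rw [h, he'] at he
      have h₁ : w ∈ ({p, v} : Finset _) := he ▸ by simp
      have h₂ : v ∈ ({q, w} : Finset _) := he ▸ by simp
      simp only [Finset.mem_insert, Finset.mem_singleton] at h₁ h₂
      rcases h₁ with rfl | rfl
      · rcases h₂ with rfl | rfl
        · omega
        · rfl
      · rfl
  have hfull : ∀ e u w, u ≠ w → t.bd e = {u, w} →
      t.graph.dist r w = t.graph.dist r u + 1 → up w = e := by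
    intro e u w hne he hd
    have hw : w ≠ r := by
      rintro rfl
      simp at hd
    obtain ⟨p, hne', he', hp⟩ := hup w hw
    obtain rfl : p = u := SimpleGraph.IsTree.eq_of_adj_of_dist_add_one_eq (G := t.graph) t.htree
      (graph_adj.2 ⟨hne', _, he'⟩) (graph_adj.2 ⟨hne, _, he⟩) hp hd.symm
    refine t.hinj (hcard w hw) ?_ (he'.trans he.symm)
    rw [Set.mem_ofPred_eq, he, Finset.card_pair hne]
  have htop : ∀ e, ∃ u, e ≠ t.root → u ∈ t.bd e ∧ e ≠ up u ∧
      ∀ w ∈ t.bd e, w ≠ u → e = up w := by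
    intro e
    by_cases he : e = t.root
    · exact ⟨r, fun h => absurd he h⟩
    rcases t.hcard e with h1 | h2
    · obtain ⟨u, hu⟩ := Finset.card_eq_one.1 h1
      refine ⟨u, fun _ => ⟨by simp [hu], ?_, fun w hw hwu => absurd (by simpa [hu] using hw) hwu⟩⟩
      rintro rfl
      by_cases hur : u = r
      · exact he (hup_root u hur)
      · have := hcard u hur
        omega
    · obtain ⟨x, y, hxy, hbd⟩ := Finset.card_eq_two.1 h2
      have key : ∀ u w, u ≠ w → t.bd e = {u, w} → t.graph.dist r w = t.graph.dist r u + 1 →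
          u ∈ t.bd e ∧ e ≠ up u ∧ ∀ w ∈ t.bd e, w ≠ u → e = up w := by
        intro u w hne hbd hd
        have hw := hfull e u w hne hbd hd
        refine ⟨by simp [hbd], fun h => hne (hinj (h.symm.trans hw.symm)), fun v hv hvu => ?_⟩
        obtain rfl : v = w := by simpa [hbd, hvu] using hv
        exact hw.symm
      rcases SimpleGraph.IsTree.dist_eq_dist_add_one_of_adj (G := t.graph) t.htree r
        (graph_adj.2 ⟨hxy, e, hbd⟩) with hd | hd
      · exact ⟨y, fun _ => key y x hxy.symm (by rw [hbd, Finset.pair_comm]) hd⟩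
      · exact ⟨x, fun _ => key x y hxy hbd hd⟩
  choose top htop using htop
  have hbd : ∀ v e, v ∈ t.bd e ↔ e = up v ∨ (e ≠ t.root ∧ up (top e) = up v) := by
    intro v e
    constructor
    · intro hv
      refine or_iff_not_imp_left.2 fun hne => ?_
      have he : e ≠ t.root := by
        rintro rfl
        rw [hr, Finset.mem_singleton] at hv
        exact hne (hv ▸ hroot.symm)
      refine ⟨he, ?_⟩
      by_contra h
      exact hne ((htop e he).2.2 v hv fun h' => h (h' ▸ rfl))
    · rintro (rfl | ⟨he, h⟩)
      · exact hmem v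
      · exact hinj h ▸ (htop e he).1
  have hchild : ∀ v, 2 ≤ {a | a ≠ t.root ∧ up (top a) = up v}.ncard := by
    intro v
    have h₁ : (Finset.univ.filter fun e => v ∈ t.bd e).erase (up v) =
        Finset.univ.filter fun a => a ≠ t.root ∧ up (top a) = up v := by
      ext a
      simp only [Finset.mem_erase, Finset.mem_filter, Finset.mem_univ, true_and, hbd]
      constructor
      · tauto
      · refine fun h => ⟨?_, .inr h⟩
        rw [← h.2]
        exact (htop a h.1).2.1
    have h₂ := t.hstable v
    have h₃ := Finset.pred_card_le_card_erase (s := Finset.univ.filter fun e => v ∈ t.bd e)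
      (a := up v)
    have h₄ := Set.ncard_coe_finset
      (Finset.univ.filter fun a => a ≠ t.root ∧ up (top a) = up v)
    rw [h₁] at h₃
    simp only [Finset.coe_filter, Finset.mem_univ, true_and] at h₄
    omega
  have hrange : ∀ e, e ∈ Set.range up ↔ ∃ a, a ≠ t.root ∧ up (top a) = e := by
    intro e
    constructor
    · rintro ⟨v, rfl⟩
      have := hchild v
      exact Set.nonempty_of_ncard_ne_zero (s := {a | a ≠ t.root ∧ up (top a) = up v}) (by omega)
    · rintro ⟨a, -, rfl⟩
      exact ⟨_, rfl⟩
  refine ⟨⟨t.root, fun e => up (top e),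
    fun e => if e = t.root then 0 else t.graph.dist r (top e) + 1, ?_, ?_⟩,
    up, hinj, rfl, hbd, hrange, ?_⟩
  · intro e he
    rw [if_neg he]
    split_ifs with h
    · omega
    · have hur : top e ≠ r := fun h' => h (hup_root _ h')
      obtain ⟨p, hne, he', hp⟩ := hup _ hur
      have : top (up (top e)) = p := by
        by_contra hp'
        exact hne (hinj ((htop _ h).2.2 p (by simp [he']) (Ne.symm hp'))).symm
      rw [this]
      omega
  · intro e
    by_cases he : e ∈ Set.range up
    · obtain ⟨v, rfl⟩ := he
      have := hchild v
      change {a | a ≠ t.root ∧ up (top a) = up v}.ncard ≠ 1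
      omega
    · have : {a | a ≠ t.root ∧ up (top a) = e} = ∅ :=
        Set.eq_empty_of_forall_notMem fun a ha => he ((hrange e).2 ⟨a, ha⟩)
      change {a | a ≠ t.root ∧ up (top a) = e}.ncard ≠ 1
      simp [this]
  · intro e
    constructor
    · intro he
      have her : e ≠ t.root := fun h => he ⟨r, hroot.trans h.symm⟩
      refine ⟨her, (t.hcard e).resolve_right fun h2 => ?_⟩
      obtain ⟨w, hw, hwu⟩ := Finset.exists_mem_ne (h2 ▸ one_lt_two) (top e)
      exact he ⟨w, ((htop e her).2.2 w hw hwu).symm⟩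
    · rintro ⟨her, h1⟩ ⟨v, rfl⟩
      by_cases hv : v = r
      · exact her (hup_root v hv)
      · have := hcard v hv
        omega

/-- A binary tree encoding a stable rooted tree up to isomorphism. -/
theorem exists_code (n : ℕ) : ∃ code : StableRootedTree n → BinaryTree Bool,
    (∀ t, (code t).numNodes + 1 = n) ∧ ∀ t t', code t = code t' → TreeIso t t' := by
  choose P up hinj hroot hbd hrange hleaf using exists_parentTree (n := n)
  refine ⟨fun t => (P t).code (P t).root, fun t => ?_, fun t t' h => ?_⟩
  · classical
    rw [← BinaryTree.numLeaves_eq_numNodes_succ, ParentTree.numLeaves_code_root]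
    have : (Finset.univ.filter fun e => (P t).children e = []) =
        (Finset.univ.filter fun e => (t.bd e).card = 1).erase t.root := by
      ext e
      simp only [Finset.mem_erase, Finset.mem_filter, Finset.mem_univ, true_and]
      rw [← hleaf, hrange, List.eq_nil_iff_forall_not_mem]
      simp only [ParentTree.mem_children, not_exists]
    rw [this, Finset.card_erase_of_mem (by simp [t.hroot]), t.hhalf, Nat.add_sub_cancel]
  · obtain ⟨τ, hτroot, hτ⟩ := ParentTree.exists_equiv_of_code_eq h
    have hne : ∀ e, e ≠ (P t).root ↔ τ e ≠ (P t').root := fun e => by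
      rw [← hτroot, τ.injective.ne_iff]
    have himage : ∀ e, e ∈ Set.range (up t) ↔ τ e ∈ Set.range (up t') := by
      intro e
      rw [hrange, hrange, ← τ.exists_congr_right]
      refine exists_congr fun a => ?_
      rw [← hne]
      refine and_congr_right fun ha => ?_
      rw [← hτ a ha, τ.apply_eq_iff_eq]
    choose σ hσ using fun v => (himage (up t v)).1 ⟨v, rfl⟩
    have hσ_bij : Function.Bijective σ := by
      refine ⟨fun v w hvw => ?_, fun v' => ?_⟩
      · exact hinj t (τ.injective (by rw [← hσ, ← hσ, hvw]))
      · obtain ⟨v, hv⟩ := (himage (τ.symm (up t' v'))).2 ⟨v', by simp⟩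
        exact ⟨v, hinj t' (by rw [hσ, hv, τ.apply_symm_apply])⟩
    refine ⟨Equiv.ofBijective σ hσ_bij, τ, fun e => ?_, by rw [← hroot, hτroot, hroot]⟩
    ext v'
    obtain ⟨v, rfl⟩ := hσ_bij.2 v'
    simp only [Finset.mem_image, Equiv.ofBijective_apply, hσ_bij.1.eq_iff, exists_eq_right]
    rw [hbd, hbd, hσ, τ.apply_eq_iff_eq, ← hne]
    refine or_congr_right (and_congr_right fun he => ?_)
    rw [← hτ e he, τ.apply_eq_iff_eq]

theorem finite_and_card_quot_le (m : ℕ) : Finite (Quot (@TreeIso (m + 1))) ∧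
    Nat.card (Quot (@TreeIso (m + 1))) ≤ catalan m * 2 ^ m := by
  obtain ⟨code, hnodes, hiso⟩ := exists_code (m + 1)
  let f : Quot (@TreeIso (m + 1)) → {x : BinaryTree Bool // x.numNodes = m} :=
    fun q => ⟨code q.out, Nat.succ_injective (hnodes _)⟩
  have hf : Function.Injective f := fun q q' h => by
    rw [← q.out_eq, ← q'.out_eq]
    exact Quot.sound (hiso _ _ (congrArg Subtype.val h))
  exact ⟨.of_injective f hf,
    (Nat.card_le_card_of_injective f hf).trans (BinaryTree.card_numNodes_eq_le m)⟩

end StableRootedTree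

theorem Nat.three_mul_add_one_mul_centralBinom_sq_le (m : ℕ) :
    (3 * m + 1) * m.centralBinom ^ 2 ≤ 16 ^ m := by
  induction m with
  | zero => simp
  | succ m ih =>
    have h := Nat.succ_mul_centralBinom_succ m
    refine Nat.le_of_mul_le_mul_left ?_ (by positivity : 0 < (m + 1) ^ 2)
    calc (m + 1) ^ 2 * ((3 * (m + 1) + 1) * (m + 1).centralBinom ^ 2)
        = (3 * m + 4) * ((m + 1) * (m + 1).centralBinom) ^ 2 := by ring
      _ = 4 * ((3 * m + 4) * (2 * m + 1) ^ 2) * m.centralBinom ^ 2 := by rw [h]; ring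
      _ ≤ 4 * (4 * (m + 1) ^ 2 * (3 * m + 1)) * m.centralBinom ^ 2 := by
        refine Nat.mul_le_mul_right _ (Nat.mul_le_mul_left _ ?_)
        nlinarith
      _ = 16 * (m + 1) ^ 2 * ((3 * m + 1) * m.centralBinom ^ 2) := by ring
      _ ≤ 16 * (m + 1) ^ 2 * 16 ^ m := by gcongr
      _ = (m + 1) ^ 2 * 16 ^ (m + 1) := by ring

theorem catalan_mul_two_pow_le (m : ℕ) : (catalan m : ℝ) * 2 ^ m ≤
    (1 / (4 * Real.sqrt 3)) * ((2 ^ (m + 1) : ℝ) / Real.sqrt (m + 1 : ℕ)) ^ 3 := by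
  have hcat : ((m : ℝ) + 1) * catalan m = m.centralBinom := by
    exact_mod_cast succ_mul_catalan_eq_centralBinom m
  have hcb : (3 * (m : ℝ) + 1) * (m.centralBinom : ℝ) ^ 2 ≤ 16 ^ m := by
    exact_mod_cast Nat.three_mul_add_one_mul_centralBinom_sq_le m
  refine le_of_sq_le_sq ?_ (by positivity)
  have h3 : Real.sqrt 3 ^ 2 = 3 := Real.sq_sqrt (by norm_num)
  have hs : Real.sqrt (m + 1 : ℕ) ^ 2 = (m : ℝ) + 1 := by
    rw [Real.sq_sqrt (by positivity)]
    push_cast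
    ring
  have hrhs : ((1 / (4 * Real.sqrt 3)) * ((2 ^ (m + 1) : ℝ) / Real.sqrt (m + 1 : ℕ)) ^ 3) ^ 2 =
      4 * (4 ^ m * 16 ^ m) / (3 * ((m : ℝ) + 1) ^ 3) := by
    calc _ = (2 ^ (m + 1) : ℝ) ^ 6 /
          (16 * Real.sqrt 3 ^ 2 * (Real.sqrt (m + 1 : ℕ) ^ 2) ^ 3) := by
            field_simp
            ring
      _ = _ := by
        rw [h3, hs, ← mul_pow, ← pow_mul, mul_comm (m + 1), pow_mul, pow_succ]
        norm_num
        field_simp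
        ring
  rw [hrhs, le_div_iff₀ (by positivity)]
  calc ((catalan m : ℝ) * 2 ^ m) ^ 2 * (3 * ((m : ℝ) + 1) ^ 3)
      = 4 ^ m * ((3 * (m + 1)) * (((m : ℝ) + 1) * catalan m) ^ 2) := by
        rw [show (4 : ℝ) ^ m = (2 ^ m) ^ 2 by rw [← pow_mul, mul_comm, pow_mul]; norm_num]
        ring
    _ = 4 ^ m * ((3 * (m + 1)) * (m.centralBinom : ℝ) ^ 2) := by rw [hcat]
    _ ≤ 4 ^ m * ((4 * (3 * m + 1)) * (m.centralBinom : ℝ) ^ 2) := by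
        have : (0 : ℝ) ≤ m := Nat.cast_nonneg m
        refine mul_le_mul_of_nonneg_left (mul_le_mul_of_nonneg_right ?_ ?_) ?_
        · linarith
        · positivity
        · positivity
    _ = 4 * (4 ^ m * ((3 * m + 1) * (m.centralBinom : ℝ) ^ 2)) := by ring
    _ ≤ 4 * (4 ^ m * 16 ^ m) := by gcongr

/-- the number `T_n` of isomorphism classes of stable rooted trees
with `n+1` half edges is finite and satisfies `T_n ≤ (1/(4√3))·(2ⁿ/√n)³`. -/
theorem stable_rooted_tree_bound (n : ℕ) (hn : 2 ≤ n) :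
    Finite (Quot (@TreeIso n)) ∧
    (Nat.card (Quot (@TreeIso n)) : ℝ) ≤
      (1 / (4 * Real.sqrt 3)) * ((2 ^ n : ℝ) / Real.sqrt n) ^ 3 := by
  obtain ⟨m, rfl⟩ : ∃ m, n = m + 1 := ⟨n - 1, by omega⟩
  obtain ⟨hfin, hcard⟩ := StableRootedTree.finite_and_card_quot_le m
  refine ⟨hfin, le_trans ?_ (catalan_mul_two_pow_le m)⟩
  exact_mod_cast hcard
end
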